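/- Let G = A *_C B be an amalgamated free product over a finite subgroup C, and let H be a finite-index normal subgroup of G with H ∩ C = 1. Then d(H) - 1 = [G : HA](d(A ∩ H) - 1) + [G : HB](d(B ∩ H) - 1) + [G : H]/|C|, where d denotes minimal number of generators and the Grushko–Neumann theorem is used to compute d of the resulting free product decomposition of H. -/

import Mathlib

open Monoid

/-- `ngen G` is `d(G)`, the minimal number of generators of the group `G`. -/
noncomputable def ngen (G : Type*) [Group G] : ℕ :=
  sInf {n | ∃ S : Finset G, S.card = n ∧ Subgroup.closure (S : Set G) = ⊤}

/-- The two-element family `A, B` of groups, indexed by `Bool`. -/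
abbrev Fam (A B : Type u) : Bool → Type u := fun b => bif b then A else B

instance famGroup {A B : Type u} [Group A] [Group B] : ∀ b, Group (Fam A B b) := fun b =>
  match b with
  | true => ‹Group A›
  | false => ‹Group B›

/-- The pair of homomorphisms `f : C →* A`, `g : C →* B` as a family over `Bool`, so that
`Monoid.PushoutI (fam2 f g)` is the amalgamated free product `A *_C B`. -/
abbrev fam2 {A B : Type u} {C : Type v} [Group A] [Group B] [Group C]
    (f : C →* A) (g : C →* B) : ∀ b, C →* Fam A B b := fun b =>
  match b with
  | true => f
  | false => g

section MinimalGenerators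

theorem ngen_le_card {G : Type*} [Group G] (S : Finset G)
    (hS : Subgroup.closure (S : Set G) = ⊤) : ngen G ≤ S.card :=
  Nat.sInf_le ⟨S, rfl, hS⟩

theorem exists_card_eq_ngen (G : Type*) [Group G] [Group.FG G] :
    ∃ S : Finset G, S.card = ngen G ∧ Subgroup.closure (S : Set G) = ⊤ := by
  obtain ⟨S, hS⟩ := Group.FG.out (G := G)
  exact Nat.sInf_mem (s := {n | ∃ S : Finset G, S.card = n ∧ Subgroup.closure (S : Set G) = ⊤})
    ⟨_, S, rfl, hS⟩

theorem ngen_eq_zero_of_not_fg {G : Type*} [Group G] (hG : ¬ Group.FG G) : ngen G = 0 := by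
  refine Nat.sInf_eq_zero.2 (Or.inr (Set.eq_empty_iff_forall_notMem.2 ?_))
  rintro n ⟨S, -, hS⟩
  exact hG ⟨S, hS⟩

theorem ngen_le_of_surjective {G K : Type*} [Group G] [Group K] [Group.FG G] (φ : G →* K)
    (hφ : Function.Surjective φ) : ngen K ≤ ngen G := by
  classical
  obtain ⟨S, hcard, hS⟩ := exists_card_eq_ngen G
  rw [← hcard]
  refine (ngen_le_card (S.image φ) ?_).trans Finset.card_image_le
  rw [Finset.coe_image, ← MonoidHom.map_closure, hS, ← MonoidHom.range_eq_map,
    MonoidHom.range_eq_top.2 hφ]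

theorem ngen_congr {G K : Type*} [Group G] [Group K] (φ : G ≃* K) : ngen G = ngen K := by
  by_cases hG : Group.FG G
  · have hK : Group.FG K := Group.fg_of_surjective (f := φ.toMonoidHom) φ.surjective
    exact le_antisymm (ngen_le_of_surjective φ.symm.toMonoidHom φ.symm.surjective)
      (ngen_le_of_surjective φ.toMonoidHom φ.surjective)
  · have hK : ¬ Group.FG K := fun hK =>
      hG (Group.fg_of_surjective (f := φ.symm.toMonoidHom) φ.symm.surjective)
    rw [ngen_eq_zero_of_not_fg hG, ngen_eq_zero_of_not_fg hK]

theorem ngen_closure_le {G : Type*} [Group G] (S : Finset G) :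
    ngen (Subgroup.closure (S : Set G)) ≤ S.card := by
  classical
  have hmem : ∀ s ∈ S, s ∈ Subgroup.closure (S : Set G) := fun s hs => Subgroup.subset_closure hs
  refine (ngen_le_card (S.attach.image fun s => ⟨s.1, hmem _ s.2⟩) ?_).trans
    (Finset.card_image_le.trans_eq S.card_attach)
  convert Subgroup.closure_closure_coe_preimage (k := (S : Set G)) using 2
  ext ⟨x, hx⟩
  simp

end MinimalGenerators

section InvariantSetoids

variable (H : Type*) {Ω V : Type*} [Group H] [MulAction H Ω] [MulAction H V]

/-- An equivalence relation on an `H`-set which is preserved by the action. -/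
def SMulInvariant (S : Setoid Ω) : Prop :=
  ∀ (h : H) (x y : Ω), S x y → S (h • x) (h • y)

/-- The invariant equivalence relation generated by a set of pairs. -/
def smulGen (P : Set (Ω × Ω)) : Setoid Ω :=
  sInf {S | SMulInvariant H S ∧ ∀ q ∈ P, S q.1 q.2}

/-- The equivalence relation obtained from `S` by also identifying the points of each orbit. -/
def orbitSup (S : Setoid Ω) : Setoid Ω := S ⊔ MulAction.orbitRel H Ω

/-- The stabilizer of the equivalence class of `z`. -/
def classStabilizer {S : Setoid Ω} (hS : SMulInvariant H S) (z : Ω) : Subgroup H where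
  carrier := {k | S z (k • z)}
  one_mem' := by
    show S z ((1 : H) • z)
    rw [one_smul]
  mul_mem' {a b} ha hb := by
    show S z ((a * b) • z)
    rw [mul_smul]
    exact S.trans ha (hS a _ _ hb)
  inv_mem' {a} ha := by
    show S z (a⁻¹ • z)
    have h := hS a⁻¹ _ _ ha
    rw [inv_smul_smul] at h
    exact S.symm h

variable {H}

theorem smulGen_le {P : Set (Ω × Ω)} {S : Setoid Ω} (hS : SMulInvariant H S)
    (hP : ∀ q ∈ P, S q.1 q.2) : smulGen H P ≤ S :=
  sInf_le ⟨hS, hP⟩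

theorem smulGen_of_mem {P : Set (Ω × Ω)} {q : Ω × Ω} (hq : q ∈ P) : smulGen H P q.1 q.2 :=
  fun _ hS => hS.2 q hq

theorem smulInvariant_smulGen (P : Set (Ω × Ω)) : SMulInvariant H (smulGen H P) :=
  fun h _ _ hxy S hS => hS.1 h _ _ (hxy S hS)

theorem smulGen_mono {P Q : Set (Ω × Ω)} (h : P ⊆ Q) : smulGen H P ≤ smulGen H Q :=
  smulGen_le (smulInvariant_smulGen Q) fun _ hq => smulGen_of_mem (h hq)

theorem smulInvariant_ker {p : Ω → V} (hp : ∀ (h : H) x, p (h • x) = h • p x) :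
    SMulInvariant H (Setoid.ker p) := by
  intro h x y hxy
  rw [Setoid.ker_def] at hxy ⊢
  rw [hp, hp, hxy]

theorem SMulInvariant.comap {S : Setoid V} (hS : SMulInvariant H S) {p : Ω → V}
    (hp : ∀ (h : H) x, p (h • x) = h • p x) : SMulInvariant H (Setoid.comap p S) := by
  intro h x y hxy
  rw [Setoid.comap_rel] at hxy ⊢
  rw [hp, hp]
  exact hS h _ _ hxy

theorem SMulInvariant.sup {S T : Setoid Ω} (hS : SMulInvariant H S) (hT : SMulInvariant H T) :
    SMulInvariant H (S ⊔ T) := by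
  intro h x y hxy
  have key : S ⊔ T ≤ Setoid.comap (fun z => h • z) (S ⊔ T) := by
    refine sup_le ?_ ?_
    · intro a b hab
      exact (le_sup_left : S ≤ S ⊔ T) (hS h _ _ hab)
    · intro a b hab
      exact (le_sup_right : T ≤ S ⊔ T) (hT h _ _ hab)
  exact key hxy

theorem orbitSup_rel {S : Setoid Ω} (hS : SMulInvariant H S) {x y : Ω} :
    orbitSup H S x y ↔ ∃ h : H, S x (h • y) := by
  constructor
  · let T : Setoid Ω :=
      { r := fun x y => ∃ h : H, S x (h • y)
        iseqv :=
          { refl := fun x => ⟨1, by rw [one_smul]⟩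
            symm := by
              rintro x y ⟨h, hxy⟩
              refine ⟨h⁻¹, ?_⟩
              have := hS h⁻¹ _ _ hxy
              rw [inv_smul_smul] at this
              exact S.symm this
            trans := by
              rintro x y z ⟨h, hxy⟩ ⟨k, hyz⟩
              refine ⟨h * k, ?_⟩
              rw [mul_smul]
              exact S.trans hxy (hS h _ _ hyz) } }
    have hT : orbitSup H S ≤ T := by
      refine sup_le ?_ ?_
      · intro a b hab
        exact ⟨1, by rw [one_smul]; exact hab⟩
      · rintro a b ⟨h, hab⟩
        exact ⟨h, by rw [show h • b = a from hab]⟩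
    exact fun h => hT h
  · rintro ⟨h, hxy⟩
    refine (orbitSup H S).trans ((le_sup_left : S ≤ orbitSup H S) hxy) ?_
    exact (le_sup_right : MulAction.orbitRel H Ω ≤ orbitSup H S) ⟨h, rfl⟩

theorem le_orbitSup (S : Setoid Ω) : S ≤ orbitSup H S := le_sup_left

theorem orbitSup_smul (S : Setoid Ω) (h : H) (x : Ω) : orbitSup H S (h • x) x :=
  (le_sup_right : MulAction.orbitRel H Ω ≤ orbitSup H S) ⟨h, rfl⟩

theorem orbitSup_mono {S T : Setoid Ω} (h : S ≤ T) : orbitSup H S ≤ orbitSup H T :=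
  sup_le_sup_right h _

theorem orbitSup_bot : orbitSup H (⊥ : Setoid Ω) = MulAction.orbitRel H Ω := bot_sup_eq _

theorem smulInvariant_bot : SMulInvariant H (⊥ : Setoid Ω) := by
  rintro h x y rfl
  rfl

instance finite_quotient_orbitSup [Finite (MulAction.orbitRel.Quotient H Ω)] (S : Setoid Ω) :
    Finite (Quotient (orbitSup H S)) :=
  Finite.of_surjective
    (Quotient.map' (s₁ := MulAction.orbitRel H Ω) (s₂ := orbitSup H S) id
      fun _ _ h => (le_sup_right : MulAction.orbitRel H Ω ≤ orbitSup H S) h)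
    (by rintro ⟨x⟩; exact ⟨Quotient.mk'' x, rfl⟩)

end InvariantSetoids

section QuotientCard

variable {Ω : Type*}

theorem card_quotient_succ_le {S T : Setoid Ω} [Finite (Quotient S)] (hST : S ≤ T) {x y : Ω}
    (hxy : ¬ S x y) (h : T x y) : Nat.card (Quotient T) + 1 ≤ Nat.card (Quotient S) := by
  let f : Quotient S → Quotient T := Quotient.map' id fun _ _ h => hST h
  have hf : Function.Surjective f := by
    rintro ⟨z⟩
    exact ⟨Quotient.mk'' z, rfl⟩
  have : Finite (Quotient T) := Finite.of_surjective f hf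
  refine Nat.succ_le_of_lt (lt_of_le_of_ne (Nat.card_le_card_of_surjective f hf) fun heq => ?_)
  have hinj := ((Nat.bijective_iff_surjective_and_card f).2 ⟨hf, heq.symm⟩).1
  exact hxy (Quotient.eq''.1 (hinj (a₁ := Quotient.mk'' x) (a₂ := Quotient.mk'' y)
    (Quotient.sound h)))

/-- Merging the classes of `x` and `y`. -/
def mergeSetoid (S : Setoid Ω) (x y : Ω) : Setoid Ω where
  r a b := S a b ∨ ((S a x ∨ S a y) ∧ (S b x ∨ S b y))
  iseqv :=
    { refl := fun a => Or.inl (S.refl a)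
      symm := by
        rintro a b (h | ⟨h, h'⟩)
        · exact Or.inl (S.symm h)
        · exact Or.inr ⟨h', h⟩
      trans := by
        rintro a b c (h | ⟨h, h'⟩) (k | ⟨k, k'⟩)
        · exact Or.inl (S.trans h k)
        · exact Or.inr ⟨k.imp (S.trans h) (S.trans h), k'⟩
        · exact Or.inr ⟨h, h'.imp (S.trans (S.symm k)) (S.trans (S.symm k))⟩
        · exact Or.inr ⟨h, k'⟩ }

theorem card_quotient_le_succ {S T : Setoid Ω} [Finite (Quotient T)] {x y : Ω}
    (hT : T ≤ mergeSetoid S x y) (hST : S ≤ T) :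
    Nat.card (Quotient S) ≤ Nat.card (Quotient T) + 1 := by
  classical
  let f : Quotient S → Quotient T := Quotient.map' id fun _ _ h => hST h
  let g : Quotient S → Option (Quotient T) :=
    fun c => if c = Quotient.mk'' y then none else some (f c)
  have hg : Function.Injective g := by
    rintro ⟨a⟩ ⟨b⟩ hab
    by_cases ha : (Quotient.mk'' a : Quotient S) = Quotient.mk'' y
    · by_cases hb : (Quotient.mk'' b : Quotient S) = Quotient.mk'' y
      · exact ha.trans hb.symm
      · simp only [g] at hab
        erw [if_pos ha, if_neg hb] at hab
        simp at hab
    · by_cases hb : (Quotient.mk'' b : Quotient S) = Quotient.mk'' y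
      · simp only [g] at hab
        erw [if_pos hb, if_neg ha] at hab
        simp at hab
      · simp only [g] at hab
        erw [if_neg ha, if_neg hb, Option.some_inj] at hab
        have ha' : ¬ S a y := fun h => ha (Quotient.sound' h)
        have hb' : ¬ S b y := fun h => hb (Quotient.sound' h)
        have hab' : T a b := Quotient.eq''.1 hab
        refine Quotient.sound' ?_
        rcases hT hab' with h | ⟨h, h'⟩
        · exact h
        · exact S.trans (h.resolve_right ha') (S.symm (h'.resolve_right hb'))
  have := Nat.card_le_card_of_injective g hg
  rwa [Finite.card_option] at this

end QuotientCard

section Rank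

variable {H Ω : Type*} [Group H] [MulAction H Ω]

theorem orbitSup_smulGen_insert_le (P : Set (Ω × Ω)) (q : Ω × Ω) :
    orbitSup H (smulGen H (insert q P)) ≤ mergeSetoid (orbitSup H (smulGen H P)) q.1 q.2 := by
  have hT : ∀ (h : H) (a : Ω), orbitSup H (smulGen H P) (h • a) a := orbitSup_smul _
  have hle : orbitSup H (smulGen H P) ≤ mergeSetoid (orbitSup H (smulGen H P)) q.1 q.2 :=
    fun _ _ h => Or.inl h
  have hsm : ∀ (h : H) a, mergeSetoid (orbitSup H (smulGen H P)) q.1 q.2 (h • a) a :=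
    fun h a => hle (hT h a)
  refine sup_le (smulGen_le ?_ ?_) (le_sup_right.trans hle)
  · intro h a b hab
    exact Setoid.trans' _ (hsm h a) (Setoid.trans' _ hab (Setoid.symm' _ (hsm h b)))
  · rintro r (rfl | hr)
    · exact Or.inr ⟨Or.inl (Setoid.refl' _ _), Or.inr (Setoid.refl' _ _)⟩
    · exact hle (le_orbitSup _ (smulGen_of_mem hr))

/-- A spanning forest `Q` of the graph of orbits with edge set `P`, together with a
trivialization `γ` of the action along the forest. -/
theorem exists_spanning_forest [Finite (MulAction.orbitRel.Quotient H Ω)]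
    (hfree : ∀ (h : H) (x : Ω), h • x = x → h = 1) (P : Finset (Ω × Ω)) :
    ∃ (Q : Finset (Ω × Ω)) (γ : Ω → H), Q ⊆ P ∧ (∀ (h : H) x, γ (h • x) = h * γ x) ∧
      (∀ q ∈ Q, γ q.1 = γ q.2) ∧
      (∀ x y, orbitSup H (smulGen H (P : Set (Ω × Ω))) x y → γ x = γ y →
        smulGen H (P : Set (Ω × Ω)) x y) ∧
      Nat.card (MulAction.orbitRel.Quotient H Ω) ≤
        Q.card + Nat.card (Quotient (orbitSup H (smulGen H (P : Set (Ω × Ω))))) := by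
  classical
  induction P using Finset.induction_on with
  | empty =>
    have hbot : smulGen H ((∅ : Finset (Ω × Ω)) : Set (Ω × Ω)) = ⊥ :=
      le_bot_iff.1 (smulGen_le smulInvariant_bot (by simp))
    have hex : ∀ x : Ω, ∃ h : H, h • (Quotient.mk'' x : MulAction.orbitRel.Quotient H Ω).out = x := by
      intro x
      have : MulAction.orbitRel H Ω x (Quotient.mk'' x : MulAction.orbitRel.Quotient H Ω).out :=
        Setoid.symm' _ (Quotient.mk_out (s := MulAction.orbitRel H Ω) x)
      exact this
    choose γ hγ using hex
    have hout : ∀ (h : H) x, (Quotient.mk'' (h • x) : MulAction.orbitRel.Quotient H Ω) =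
        Quotient.mk'' x := fun h x => Quotient.sound' ⟨h, rfl⟩
    refine ⟨∅, γ, Finset.Subset.refl _, ?_, by simp, ?_, ?_⟩
    · intro h x
      have h1 := hγ (h • x)
      rw [hout] at h1
      have h2 : (h * γ x)⁻¹ • γ (h • x) • (Quotient.mk'' x : MulAction.orbitRel.Quotient H Ω).out =
          (Quotient.mk'' x : MulAction.orbitRel.Quotient H Ω).out := by
        rw [h1, inv_smul_eq_iff, mul_smul, hγ]
      rw [← mul_smul] at h2
      have := hfree _ _ h2
      rw [inv_mul_eq_one] at this
      exact this.symm
    · intro x y hxy hγxy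
      rw [hbot, orbitSup_bot] at *
      have : (Quotient.mk'' x : MulAction.orbitRel.Quotient H Ω) = Quotient.mk'' y :=
        Quotient.sound' hxy
      show x = y
      rw [← hγ x, ← hγ y, this, hγxy]
    · rw [hbot, orbitSup_bot, Finset.card_empty, zero_add]
  | insert q P hqP ih =>
    obtain ⟨Q, γ, hQP, hγ, hγQ, hγP, hcard⟩ := ih
    have hmono : smulGen H (P : Set (Ω × Ω)) ≤
        smulGen H ((insert q P : Finset (Ω × Ω)) : Set (Ω × Ω)) := by
      rw [Finset.coe_insert]
      exact smulGen_mono (Set.subset_insert _ _)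
    have hq : smulGen H ((insert q P : Finset (Ω × Ω)) : Set (Ω × Ω)) q.1 q.2 :=
      smulGen_of_mem (Finset.mem_coe.2 (Finset.mem_insert_self q P))
    have hinv := smulInvariant_smulGen (H := H)
      ((insert q P : Finset (Ω × Ω)) : Set (Ω × Ω))
    have hmerge := orbitSup_smulGen_insert_le (H := H) (P : Set (Ω × Ω)) q
    rw [← Finset.coe_insert] at hmerge
    set T := orbitSup H (smulGen H (P : Set (Ω × Ω))) with hTdef
    have hTmono : T ≤ orbitSup H (smulGen H ((insert q P : Finset (Ω × Ω)) : Set (Ω × Ω))) :=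
      orbitSup_mono hmono
    have hTsm : ∀ (h : H) x, T (h • x) x := orbitSup_smul _
    by_cases hT : T q.1 q.2
    · have hTeq : ∀ x y, mergeSetoid T q.1 q.2 x y → T x y := by
        rintro x y (h | ⟨h, h'⟩)
        · exact h
        · have hx : T x q.2 := h.elim (fun h => T.trans h hT) id
          have hy : T y q.2 := h'.elim (fun h => T.trans h hT) id
          exact T.trans hx (T.symm hy)
      refine ⟨Q, γ, hQP.trans (Finset.subset_insert _ _), hγ, hγQ, ?_, ?_⟩
      · intro x y hxy hγxy
        exact hmono (hγP x y (hTeq _ _ (hmerge hxy)) hγxy)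
      · rwa [le_antisymm (fun x y h => hTeq x y (hmerge h)) hTmono]
    · refine ⟨insert q Q, fun z => if T z q.2 then γ z * ((γ q.2)⁻¹ * γ q.1) else γ z,
        Finset.insert_subset_insert _ hQP, ?_, ?_, ?_, ?_⟩
      · intro h x
        have : T (h • x) q.2 ↔ T x q.2 :=
          ⟨T.trans (T.symm (hTsm h x)), T.trans (hTsm h x)⟩
        simp only [this]
        split_ifs
        · rw [hγ, mul_assoc]
        · exact hγ h x
      · intro r hr
        rcases Finset.mem_insert.1 hr with rfl | hr
        · simp only [if_neg hT, if_pos (T.refl r.2), mul_inv_cancel_left]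
        · have hrT : T r.1 r.2 := le_orbitSup _ (smulGen_of_mem (Finset.mem_coe.2 (hQP hr)))
          have : T r.1 q.2 ↔ T r.2 q.2 := ⟨T.trans (T.symm hrT), T.trans hrT⟩
          simp only [this, hγQ r hr]
      · have hcross : ∀ x y, T x q.1 → T y q.2 → γ x = γ y * ((γ q.2)⁻¹ * γ q.1) →
            smulGen H ((insert q P : Finset (Ω × Ω)) : Set (Ω × Ω)) x y := by
          intro x y hx hy hγxy
          have h1 : smulGen H (P : Set (Ω × Ω)) x ((γ x * (γ q.1)⁻¹) • q.1) :=
            hγP _ _ (T.trans hx (T.symm (hTsm _ _))) (by rw [hγ]; group)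
          have h2 : smulGen H (P : Set (Ω × Ω)) y ((γ x * (γ q.1)⁻¹) • q.2) :=
            hγP _ _ (T.trans hy (T.symm (hTsm _ _))) (by rw [hγ, hγxy]; group)
          exact Setoid.trans' _ (hmono h1) (Setoid.trans' _ (hinv _ _ _ hq)
            (Setoid.symm' _ (hmono h2)))
        intro x y hxy hγxy
        by_cases hx : T x q.2 <;> by_cases hy : T y q.2
        · simp only [if_pos hx, if_pos hy] at hγxy
          exact hmono (hγP x y (T.trans hx (T.symm hy)) (mul_right_cancel hγxy))
        · simp only [if_pos hx, if_neg hy] at hγxy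
          rcases hmerge hxy with h | ⟨-, h⟩
          · exact absurd (T.trans (T.symm h) hx) hy
          · exact Setoid.symm' _ (hcross y x (h.resolve_right hy) hx hγxy.symm)
        · simp only [if_neg hx, if_pos hy] at hγxy
          rcases hmerge hxy with h | ⟨h, -⟩
          · exact absurd (T.trans h hy) hx
          · exact hcross x y (h.resolve_right hx) hy hγxy
        · simp only [if_neg hx, if_neg hy] at hγxy
          rcases hmerge hxy with h | ⟨h, h'⟩
          · exact hmono (hγP x y h hγxy)
          · exact hmono (hγP x y
              (T.trans (h.resolve_right hx) (T.symm (h'.resolve_right hy))) hγxy)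
      · have hqQ : q ∉ Q := fun h => hqP (hQP h)
        rw [Finset.card_insert_of_notMem hqQ]
        have := card_quotient_le_succ hmerge hTmono
        omega

/-- If every class of the invariant equivalence relation generated by `P` has a stabilizer
needing at least `d` generators, then `P` has at least `|Ω / H| + m (d - 1)` elements, where `m`
is the number of orbits of classes. -/
theorem card_orbits_add_le_card [Finite (MulAction.orbitRel.Quotient H Ω)]
    (hfree : ∀ (h : H) (x : Ω), h • x = x → h = 1) (P : Finset (Ω × Ω)) {S : Setoid Ω}
    (hS : SMulInvariant H S) (hP : smulGen H (P : Set (Ω × Ω)) = S) (d : ℕ)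
    (hd : ∀ z, d ≤ ngen (classStabilizer H hS z)) :
    Nat.card (MulAction.orbitRel.Quotient H Ω) + Nat.card (Quotient (orbitSup H S)) * d ≤
      P.card + Nat.card (Quotient (orbitSup H S)) := by
  classical
  obtain ⟨Q, γ, hQP, hγ, hγQ, hγP, hcard⟩ := exists_spanning_forest hfree P
  rw [hP] at hγP hcard
  have : Fintype (Quotient (orbitSup H S)) := Fintype.ofFinite _
  let fib : Quotient (orbitSup H S) → Finset (Ω × Ω) :=
    fun j => (P \ Q).filter fun q => (Quotient.mk'' q.1 : Quotient (orbitSup H S)) = j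
  have hPS : ∀ q ∈ P, S q.1 q.2 := by
    intro q hq
    rw [← hP]
    exact smulGen_of_mem (Finset.mem_coe.2 hq)
  have hTsm : ∀ (h : H) x, orbitSup H S (h • x) x := orbitSup_smul _
  have hST : S ≤ orbitSup H S := le_orbitSup S
  have hfib : ∀ j, d ≤ (fib j).card := by
    intro j
    obtain ⟨z, rfl⟩ := Quotient.exists_rep j
    let gens : Finset H := (fib ⟦z⟧).image fun q => γ z * (γ q.1)⁻¹ * γ q.2 * (γ z)⁻¹
    suffices h : classStabilizer H hS z = Subgroup.closure (gens : Set H) by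
      refine (hd z).trans ?_
      rw [h]
      exact (ngen_closure_le gens).trans Finset.card_image_le
    apply le_antisymm
    · let L := Subgroup.closure (gens : Set H)
      let U : Setoid Ω :=
        { r := fun x y => orbitSup H S x y ∧
            (orbitSup H S x z → γ z * (γ x)⁻¹ * γ y * (γ z)⁻¹ ∈ L)
          iseqv :=
            { refl := fun x => ⟨Setoid.refl' _ x, fun _ => by simp⟩
              symm := by
                rintro x y ⟨h, h'⟩
                refine ⟨Setoid.symm' _ h, fun hy => ?_⟩
                have := L.inv_mem (h' (Setoid.trans' _ h hy))
                convert this using 1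
                group
              trans := by
                rintro x y w ⟨h, h'⟩ ⟨k, k'⟩
                refine ⟨Setoid.trans' _ h k, fun hx => ?_⟩
                have := L.mul_mem (h' hx) (k' (Setoid.trans' _ (Setoid.symm' _ h) hx))
                convert this using 1
                group } }
      have hU : S ≤ U := by
        rw [← hP]
        refine smulGen_le ?_ ?_
        · rintro h x y ⟨hxy, hL⟩
          refine ⟨Setoid.trans' _ (hTsm h x) (Setoid.trans' _ hxy (Setoid.symm' _ (hTsm h y))), ?_⟩
          intro hx
          have := hL (Setoid.trans' _ (Setoid.symm' _ (hTsm h x)) hx)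
          rw [hγ, hγ]
          convert this using 1
          group
        · intro q hq
          refine ⟨hST (hPS q hq), fun hqz => ?_⟩
          by_cases hqQ : q ∈ Q
          · rw [hγQ q hqQ]
            simp
          · refine Subgroup.subset_closure (Finset.mem_coe.2 (Finset.mem_image.2 ⟨q, ?_, rfl⟩))
            exact Finset.mem_filter.2 ⟨Finset.mem_sdiff.2 ⟨hq, hqQ⟩, Quotient.sound' hqz⟩
      intro k hk
      have := (hU hk).2 (Setoid.refl' _ z)
      rw [hγ] at this
      simpa using this
    · rw [Subgroup.closure_le]
      intro k hk
      obtain ⟨q, hq, rfl⟩ := Finset.mem_image.1 (Finset.mem_coe.1 hk)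
      have hq' := Finset.mem_filter.1 hq
      have hqz : orbitSup H S q.1 z := Quotient.eq''.1 hq'.2
      have hqP := (Finset.mem_sdiff.1 hq'.1).1
      have h1 : S z ((γ z * (γ q.1)⁻¹) • q.1) :=
        hγP _ _ (Setoid.trans' _ (Setoid.symm' _ hqz) (Setoid.symm' _ (hTsm _ _)))
          (by rw [hγ]; group)
      have h2 : S ((γ z * (γ q.1)⁻¹) • q.1) ((γ z * (γ q.1)⁻¹) • q.2) := hS _ _ _ (hPS q hqP)
      have h3 : S ((γ z * (γ q.1)⁻¹) • q.2) ((γ z * (γ q.1)⁻¹ * γ q.2 * (γ z)⁻¹) • z) := by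
        refine hγP _ _ ?_ ?_
        · exact Setoid.trans' _ (Setoid.symm' _ (hST (S.trans h1 h2))) (Setoid.symm' _ (hTsm _ _))
        · rw [hγ, hγ]
          group
      exact S.trans h1 (S.trans h2 h3)
  have hsum : Fintype.card (Quotient (orbitSup H S)) * d ≤ (P \ Q).card := by
    rw [Finset.card_eq_sum_card_fiberwise (f := fun q : Ω × Ω =>
      (Quotient.mk'' q.1 : Quotient (orbitSup H S))) (t := Finset.univ) (fun _ _ => by simp)]
    calc Fintype.card (Quotient (orbitSup H S)) * d
        = ∑ _j : Quotient (orbitSup H S), d := by simp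
      _ ≤ _ := Finset.sum_le_sum fun j _ => hfib j
  have hPQ := Finset.card_sdiff_add_card_eq_card hQP
  rw [← Nat.card_eq_fintype_card] at hsum
  omega

/-- An invariant equivalence relation whose class stabilizers are generated by at most `d`
elements is generated by `|Ω / H| + m (d - 1)` pairs, where `m` is the number of orbits of
classes. -/
theorem exists_smulGen_eq [Finite (MulAction.orbitRel.Quotient H Ω)] {S : Setoid Ω}
    (hS : SMulInvariant H S) (d : ℕ)
    (hd : ∀ z, ∃ K : Finset H, K.card ≤ d ∧
      Subgroup.closure (K : Set H) = classStabilizer H hS z) :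
    ∃ P : Finset (Ω × Ω), smulGen H (P : Set (Ω × Ω)) = S ∧
      P.card + Nat.card (Quotient (orbitSup H S)) ≤
        Nat.card (MulAction.orbitRel.Quotient H Ω) + Nat.card (Quotient (orbitSup H S)) * d := by
  classical
  have : Fintype (Quotient (orbitSup H S)) := Fintype.ofFinite _
  have : Fintype (MulAction.orbitRel.Quotient H Ω) := Fintype.ofFinite _
  choose K hKd hK using hd
  let comp : MulAction.orbitRel.Quotient H Ω → Quotient (orbitSup H S) :=
    Quotient.map' id fun _ _ h => (le_sup_right : MulAction.orbitRel H Ω ≤ orbitSup H S) h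
  let orb : Ω → MulAction.orbitRel.Quotient H Ω := Quotient.mk''
  have hcomp : ∀ e, ∃ w : Ω, orb w = e ∧ S (comp e).out w := by
    intro e
    obtain ⟨x, rfl⟩ := Quotient.exists_rep e
    have h1 : orbitSup H S (comp ⟦x⟧).out x := Quotient.mk_out (s := orbitSup H S) x
    obtain ⟨h, hx⟩ := (orbitSup_rel hS).1 h1
    exact ⟨h • x, Quotient.sound' ⟨h, rfl⟩, hx⟩
  choose rep hrep hrepS using hcomp
  let roots : Finset (MulAction.orbitRel.Quotient H Ω) :=
    Finset.univ.image fun j : Quotient (orbitSup H S) => orb j.out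
  have hroots : roots.card = Fintype.card (Quotient (orbitSup H S)) := by
    refine Finset.card_image_of_injective _ fun i j hij => ?_
    have : comp (orb i.out) = comp (orb j.out) := congrArg comp hij
    have hc : ∀ k : Quotient (orbitSup H S), comp (orb k.out) = k := fun k => Quotient.out_eq' k
    rwa [hc, hc] at this
  let P : Finset (Ω × Ω) := (rootsᶜ.image fun e => ((comp e).out, rep e)) ∪
    Finset.univ.biUnion fun j : Quotient (orbitSup H S) =>
      (K j.out).image fun s => (j.out, s • j.out)
  have hgenS : smulGen H (P : Set (Ω × Ω)) ≤ S := by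
    refine smulGen_le hS ?_
    intro q hq
    rcases Finset.mem_union.1 (Finset.mem_coe.1 hq) with hq | hq
    · obtain ⟨e, -, rfl⟩ := Finset.mem_image.1 hq
      exact hrepS e
    · obtain ⟨j, -, hq⟩ := Finset.mem_biUnion.1 hq
      obtain ⟨s, hs, rfl⟩ := Finset.mem_image.1 hq
      have : s ∈ classStabilizer H hS j.out := by
        rw [← hK]
        exact Subgroup.subset_closure hs
      exact this
  refine ⟨P, le_antisymm hgenS ?_, ?_⟩
  · have hinv := smulInvariant_smulGen (H := H) (P : Set (Ω × Ω))
    have hstab : ∀ (j : Quotient (orbitSup H S)) (k : H), S j.out (k • j.out) →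
        smulGen H (P : Set (Ω × Ω)) j.out (k • j.out) := by
      intro j k hk
      have hle : Subgroup.closure (K j.out : Set H) ≤ classStabilizer H hinv j.out := by
        rw [Subgroup.closure_le]
        intro s hs
        exact smulGen_of_mem (q := (j.out, s • j.out)) (Finset.mem_coe.2 (Finset.mem_union_right _
          (Finset.mem_biUnion.2 ⟨j, Finset.mem_univ _, Finset.mem_image_of_mem _ hs⟩)))
      rw [hK] at hle
      exact hle hk
    have hreach : ∀ x : Ω, ∃ h : H,
        smulGen H (P : Set (Ω × Ω)) (h • (comp (orb x)).out) x := by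
      intro x
      by_cases hx : orb x ∈ roots
      · obtain ⟨j, -, hj⟩ := Finset.mem_image.1 hx
        have hj' : comp (orb x) = j := by
          rw [← hj]
          exact Quotient.out_eq' j
        obtain ⟨h, hh⟩ : MulAction.orbitRel H Ω x j.out := Quotient.eq''.1 hj.symm
        refine ⟨h, ?_⟩
        rw [hj', show h • j.out = x from hh]
      · obtain ⟨h, hh⟩ : MulAction.orbitRel H Ω x (rep (orb x)) :=
          Quotient.eq''.1 (hrep (orb x)).symm
        refine ⟨h, ?_⟩
        have := hinv h _ _ (smulGen_of_mem (q := ((comp (orb x)).out, rep (orb x)))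
          (Finset.mem_coe.2 (Finset.mem_union_left _
            (Finset.mem_image_of_mem _ (Finset.mem_compl.2 hx)))))
        rwa [show h • rep (orb x) = x from hh] at this
    intro x y hxy
    have hxy' : comp (orb x) = comp (orb y) := Quotient.sound' (le_orbitSup S hxy)
    obtain ⟨h, hx⟩ := hreach x
    obtain ⟨k, hy⟩ := hreach y
    rw [← hxy'] at hy
    have h1 : S (h • (comp (orb x)).out) (k • (comp (orb x)).out) :=
      S.trans (hgenS hx) (S.trans hxy (S.symm (hgenS hy)))
    have h2 := hS h⁻¹ _ _ h1
    rw [inv_smul_smul, ← mul_smul] at h2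
    have h3 := hinv h _ _ (hstab _ _ h2)
    rw [← mul_smul, mul_inv_cancel_left] at h3
    exact Setoid.trans' _ (Setoid.symm' _ hx) (Setoid.trans' _ h3 hy)
  · have h1 : (rootsᶜ.image fun e => ((comp e).out, rep e)).card ≤
        Fintype.card (MulAction.orbitRel.Quotient H Ω) -
          Fintype.card (Quotient (orbitSup H S)) := by
      rw [← hroots, ← Finset.card_compl]
      exact Finset.card_image_le
    have h2 : (Finset.univ.biUnion fun j : Quotient (orbitSup H S) =>
        (K j.out).image fun s => (j.out, s • j.out)).card ≤
          Fintype.card (Quotient (orbitSup H S)) * d := by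
      refine Finset.card_biUnion_le_card_mul _ _ _ fun j _ => ?_
      exact Finset.card_image_le.trans (hKd _)
    have h3 := Finset.card_union_le (rootsᶜ.image fun e => ((comp e).out, rep e))
      (Finset.univ.biUnion fun j : Quotient (orbitSup H S) =>
        (K j.out).image fun s => (j.out, s • j.out))
    have h4 : Fintype.card (Quotient (orbitSup H S)) ≤
        Fintype.card (MulAction.orbitRel.Quotient H Ω) := by
      rw [← hroots]
      exact Finset.card_le_univ _
    rw [Nat.card_eq_fintype_card, Nat.card_eq_fintype_card]
    change (_ ∪ _ : Finset (Ω × Ω)).card + _ ≤ _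
    omega

end Rank

section Folding

variable {H Ω V : Type*} [Group H] [MulAction H Ω] [MulAction H V]

/-- Successively identifying pairs of points with the same image that are related by one of the two
generated relations does not increase the number of generating pairs plus the number of orbits. -/
theorem exists_folded [Finite (MulAction.orbitRel.Quotient H Ω)] {p : Ω → V}
    (hp : ∀ (h : H) x, p (h • x) = h • p x) (hfree : ∀ (h : H) (v : V), h • v = v → h = 1)
    {α : Bool → Setoid V} (n : ℕ) :
    ∀ (P : Bool → Finset (Ω × Ω)) (R : Setoid Ω),
      (∀ b, ∀ q ∈ P b, α b (p q.1) (p q.2)) → SMulInvariant H R → R ≤ Setoid.ker p →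
      (∀ b, R ≤ smulGen H (P b : Set (Ω × Ω))) → Nat.card (Quotient (orbitSup H R)) = n →
      ∃ (P' : Bool → Finset (Ω × Ω)) (R' : Setoid Ω),
        (∀ b, ∀ q ∈ P' b, α b (p q.1) (p q.2)) ∧ SMulInvariant H R' ∧ R' ≤ Setoid.ker p ∧
        (∀ b, R' ≤ smulGen H (P' b : Set (Ω × Ω))) ∧ (∀ b, P b ⊆ P' b) ∧
        (∀ b x y, smulGen H (P' b : Set (Ω × Ω)) x y → p x = p y → R' x y) ∧
        (P' true).card + (P' false).card + Nat.card (Quotient (orbitSup H R')) ≤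
          (P true).card + (P false).card + n := by
  classical
  induction n using Nat.strong_induction_on with
  | _ n ih =>
    intro P R hP hR hRp hRP hn
    by_cases hterm : ∀ b x y, smulGen H (P b : Set (Ω × Ω)) x y → p x = p y → R x y
    · exact ⟨P, R, hP, hR, hRp, hRP, fun _ => Finset.Subset.refl _, hterm, by rw [hn]⟩
    · push Not at hterm
      obtain ⟨b, x, y, hxy, hpxy, hRxy⟩ := hterm
      have hnot : ¬ orbitSup H R x y := by
        rw [orbitSup_rel hR]
        rintro ⟨h, hh⟩
        have h1 : p x = h • p y := by
          rw [← hp]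
          exact hRp hh
        have h2 := hfree h (p y) (by rw [← h1, hpxy])
        rw [h2, one_smul] at hh
        exact hRxy hh
      let R' : Setoid Ω := R ⊔ smulGen H {(x, y)}
      have hRR' : R ≤ R' := le_sup_left
      have hgen : smulGen H {(x, y)} ≤ R' := le_sup_right
      have hxyR' : R' x y := hgen (smulGen_of_mem (q := (x, y)) rfl)
      have hlt := card_quotient_succ_le (orbitSup_mono (H := H) hRR') hnot (le_orbitSup R' hxyR')
      let P' : Bool → Finset (Ω × Ω) := Function.update P (!b) (insert (x, y) (P (!b)))
      have hP'b : P' b = P b := Function.update_of_ne (by simp) _ _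
      have hP'nb : P' (!b) = insert (x, y) (P (!b)) := Function.update_self _ _ _
      have hsub : ∀ c, P c ⊆ P' c := by
        intro c
        rcases Bool.eq_or_eq_not c b with rfl | rfl
        · rw [hP'b]
        · rw [hP'nb]
          exact Finset.subset_insert _ _
      have hmemP' : ∀ c, smulGen H (P' c : Set (Ω × Ω)) x y := by
        intro c
        rcases Bool.eq_or_eq_not c b with rfl | rfl
        · rwa [hP'b]
        · rw [hP'nb]
          exact smulGen_of_mem (q := (x, y)) (by simp)
      have hrelP' : ∀ c, ∀ q ∈ P' c, α c (p q.1) (p q.2) := by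
        intro c q hq
        rcases Bool.eq_or_eq_not c b with rfl | rfl
        · rw [hP'b] at hq
          exact hP _ q hq
        · rw [hP'nb] at hq
          rcases Finset.mem_insert.1 hq with rfl | hq
          · show α _ (p x) (p y)
            rw [hpxy]
          · exact hP _ q hq
      have hR'p : R' ≤ Setoid.ker p := by
        refine sup_le hRp (smulGen_le (smulInvariant_ker hp) ?_)
        rintro q rfl
        exact hpxy
      have hR'P' : ∀ c, R' ≤ smulGen H (P' c : Set (Ω × Ω)) := by
        intro c
        refine sup_le ((hRP c).trans (smulGen_mono (Finset.coe_subset.2 (hsub c))))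
          (smulGen_le (smulInvariant_smulGen _) ?_)
        rintro q rfl
        exact hmemP' c
      obtain ⟨P'', R'', h1, h2, h3, h4, h5, h6, h7⟩ :=
        ih (Nat.card (Quotient (orbitSup H R'))) (by omega) P' R' hrelP'
          (hR.sup (smulInvariant_smulGen _)) hR'p hR'P' rfl
      refine ⟨P'', R'', h1, h2, h3, h4, fun c => (hsub c).trans (h5 c), h6, h7.trans ?_⟩
      have hcard : (P' true).card + (P' false).card ≤ (P true).card + (P false).card + 1 := by
        have hins := Finset.card_insert_le (x, y) (P (!b))
        rw [← hP'nb] at hins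
        cases b
        · rw [hP'b]
          simp only [Bool.not_false] at hins
          omega
        · rw [hP'b]
          simp only [Bool.not_true] at hins
          omega
      omega

end Folding

section ReducedPaths

/-- Paths whose consecutive steps are alternately related by `X true` and `X false` and change the
value of `p`. The index records the kind of the last step. -/
inductive ReducedPath {Ω V : Type*} (p : Ω → V) (X : Bool → Setoid Ω) : Bool → Ω → Ω → Prop
  | single {b x y} : X b x y → p x ≠ p y → ReducedPath p X b x y
  | snoc {b x y z} : ReducedPath p X (!b) x y → X b y z → p y ≠ p z → ReducedPath p X b x z

variable {Ω V : Type*} {p : Ω → V} {X : Bool → Setoid Ω} {α : Bool → Setoid V}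

theorem ReducedPath.map (hX : ∀ b, X b ≤ Setoid.comap p (α b)) {b : Bool} {x y : Ω}
    (h : ReducedPath p X b x y) : ReducedPath id α b (p x) (p y) := by
  induction h with
  | single h hne => exact .single (hX _ h) hne
  | snoc _ h hne ih => exact .snoc ih (hX _ h) hne

theorem eq_or_exists_reducedPath {R : Setoid Ω} (hRX : ∀ b, R ≤ X b)
    (hXR : ∀ b x y, X b x y → p x = p y → R x y)
    (hconn : X true ⊔ X false = ⊤) (x z : Ω) :
    R x z ∨ ∃ b y, ReducedPath p X b x y ∧ R y z := by
  let s : Set Ω := {z | R x z ∨ ∃ b y, ReducedPath p X b x y ∧ R y z}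
  have hstep : ∀ c z z', X c z z' → z ∈ s → z' ∈ s := by
    rintro c z z' hz (hxz | ⟨b, y, hxy, hyz⟩)
    · have hxz' : X c x z' := (X c).trans (hRX c hxz) hz
      by_cases hne : p x = p z'
      · exact Or.inl (hXR c _ _ hxz' hne)
      · exact Or.inr ⟨c, z', .single hxz' hne, R.refl z'⟩
    · have hyz' : X c y z' := (X c).trans (hRX c hyz) hz
      by_cases hne : p y = p z'
      · exact Or.inr ⟨b, y, hxy, hXR c _ _ hyz' hne⟩
      · rcases Bool.eq_or_eq_not b c with rfl | rfl
        · cases hxy with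
          | single hxy _ =>
            have hxz' : X b x z' := (X b).trans hxy hyz'
            by_cases hne : p x = p z'
            · exact Or.inl (hXR b _ _ hxz' hne)
            · exact Or.inr ⟨b, z', .single hxz' hne, R.refl z'⟩
          | @snoc _ _ w _ hxw hwy _ =>
            have hwz' : X b w z' := (X b).trans hwy hyz'
            by_cases hne : p w = p z'
            · exact Or.inr ⟨!b, w, hxw, hXR b _ _ hwz' hne⟩
            · exact Or.inr ⟨b, z', .snoc hxw hwz' hne, R.refl z'⟩
        · exact Or.inr ⟨c, z', .snoc hxy hyz' hne, R.refl z'⟩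
  have hle : ∀ c, X c ≤ Setoid.ker (fun z => z ∈ s) := fun c z z' h =>
    propext ⟨hstep c z z' h, hstep c z' z ((X c).symm h)⟩
  have htop : Setoid.ker (fun z => z ∈ s) x z :=
    (sup_le (hle true) (hle false)) (by rw [hconn]; trivial)
  have hx : x ∈ s := Or.inl (R.refl x)
  exact (Eq.mp htop hx : z ∈ s)

theorem ker_le_of_no_reduced_loop (htree : ∀ b u, ¬ ReducedPath id α b u u)
    (hX : ∀ b, X b ≤ Setoid.comap p (α b)) {R : Setoid Ω} (hRp : R ≤ Setoid.ker p)
    (hRX : ∀ b, R ≤ X b) (hXR : ∀ b x y, X b x y → p x = p y → R x y)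
    (hconn : X true ⊔ X false = ⊤) : Setoid.ker p ≤ R := by
  intro x z hxz
  rcases eq_or_exists_reducedPath hRX hXR hconn x z with h | ⟨b, y, hxy, hyz⟩
  · exact h
  · have h1 := hxy.map hX
    rw [show p y = p z from hRp hyz, ← show p x = p z from hxz] at h1
    exact absurd h1 (htree _ _)

theorem comap_le_of_no_reduced_loop (htree : ∀ b u, ¬ ReducedPath id α b u u)
    (hX : ∀ b, X b ≤ Setoid.comap p (α b)) {R : Setoid Ω} (hRp : R ≤ Setoid.ker p)
    (hRX : ∀ b, R ≤ X b) (hXR : ∀ b x y, X b x y → p x = p y → R x y)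
    (hconn : X true ⊔ X false = ⊤) (c : Bool) : Setoid.comap p (α c) ≤ X c := by
  intro x z hxz
  rcases eq_or_exists_reducedPath hRX hXR hconn x z with h | ⟨b, y, hxy, hyz⟩
  · exact hRX c h
  · have hpyz : p y = p z := hRp hyz
    have hyx : α c (p y) (p x) := by
      rw [hpyz]
      exact (α c).symm hxz
    have hmap := hxy.map hX
    have hne : p y ≠ p x := fun h => htree b (p x) (by rwa [h] at hmap)
    rcases Bool.eq_or_eq_not b c with rfl | rfl
    · cases hxy with
      | single hxy _ => exact (X b).trans hxy (hRX b hyz)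
      | @snoc _ _ w _ hxw hwy _ =>
        have hmap' := hxw.map hX
        have hwx : p w ≠ p x := fun h => htree (!b) (p x) (by rwa [h] at hmap')
        exact absurd (.snoc hmap' ((α b).trans (hX b hwy) hyx) hwx) (htree b (p x))
    · exact absurd (.snoc hmap hyx hne) (htree c (p x))

end ReducedPaths

section Unfolding

universe w

/-- An `H`-set `Ω` over `V` containing a copy of `V`, with two families of pairs of points which are
related by `α true` and `α false` in `V`. The parameter `k` bounds the number of pairs minus the
number of orbits of `Ω` outside `V`. -/
structure Unfolding (H V : Type w) [Group H] [MulAction H V] (α : Bool → Setoid V) (k : ℕ) where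
  Ω : Type w
  [act : MulAction H Ω]
  [fin : Finite (MulAction.orbitRel.Quotient H Ω)]
  p : Ω → V
  s : V → Ω
  p_smul : ∀ (h : H) x, p (h • x) = h • p x
  s_smul : ∀ (h : H) v, s (h • v) = h • s v
  p_s : ∀ v, p (s v) = v
  P : Bool → Finset (Ω × Ω)
  rel_P : ∀ b, ∀ q ∈ P b, α b (p q.1) (p q.2)
  reach : ∀ x, ∃ v, smulGen H {q | ∃ b, q ∈ P b} (s v) x
  card_le : (P true).card + (P false).card + Nat.card (MulAction.orbitRel.Quotient H V) ≤
    Nat.card (MulAction.orbitRel.Quotient H Ω) + k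

attribute [instance] Unfolding.act Unfolding.fin

theorem natCard_orbits_sum_self (H Ω : Type*) [Group H] [MulAction H Ω]
    [Finite (MulAction.orbitRel.Quotient H Ω)] :
    Finite (MulAction.orbitRel.Quotient H (Ω ⊕ H)) ∧
      Nat.card (MulAction.orbitRel.Quotient H Ω) + 1 ≤
        Nat.card (MulAction.orbitRel.Quotient H (Ω ⊕ H)) := by
  let ι : MulAction.orbitRel.Quotient H Ω → MulAction.orbitRel.Quotient H (Ω ⊕ H) :=
    Quotient.map' Sum.inl fun _ _ ⟨h, hh⟩ => ⟨h, congrArg Sum.inl hh⟩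
  let f : Option (MulAction.orbitRel.Quotient H Ω) → MulAction.orbitRel.Quotient H (Ω ⊕ H) :=
    fun o => o.elim (Quotient.mk'' (Sum.inr 1)) ι
  have hsurj : Function.Surjective f := by
    rintro ⟨x | h⟩
    · exact ⟨some (Quotient.mk'' x), rfl⟩
    · exact ⟨none, Quotient.sound' ⟨h⁻¹, congrArg Sum.inr (inv_mul_cancel h)⟩⟩
  have hinj : Function.Injective f := by
    rintro (_ | ⟨⟨x⟩⟩) (_ | ⟨⟨y⟩⟩) hxy
    · rfl
    · obtain ⟨h, hh⟩ := Quotient.eq''.1 hxy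
      cases hh
    · obtain ⟨h, hh⟩ := Quotient.eq''.1 hxy
      cases hh
    · obtain ⟨h, hh⟩ := Quotient.eq''.1 hxy
      exact congrArg some (Quotient.sound' ⟨h, Sum.inl_injective hh⟩)
  have hfin := Finite.of_surjective f hsurj
  have := Nat.card_le_card_of_injective f hinj
  rw [Finite.card_option] at this
  exact ⟨hfin, this⟩

namespace Unfolding

variable {H V : Type w} [Group H] [MulAction H V] {α : Bool → Setoid V} {k : ℕ}

/-- The relation generated by all the pairs of an unfolding. -/
def gen (U : Unfolding H V α k) : Setoid U.Ω := smulGen H {q | ∃ b, q ∈ U.P b}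

/-- The relation induced by `U.gen` on the copy of `V`. -/
def rel (U : Unfolding H V α k) : Setoid V := Setoid.comap U.s U.gen

/-- Some point above `v` is related to the copy of `u`. -/
def Reaches (U : Unfolding H V α k) (u v : V) : Prop := ∃ x, U.p x = v ∧ U.gen (U.s u) x

theorem exists_reaches_step (U : Unfolding H V α k) {u v v' : V} (hU : U.Reaches u v) (b : Bool)
    (hv : α b v v') : ∃ U' : Unfolding H V α k, U.rel ≤ U'.rel ∧ U'.Reaches u v' := by
  classical
  obtain ⟨x, rfl, hx⟩ := hU
  obtain ⟨hfin, hcard⟩ := natCard_orbits_sum_self H U.Ω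
  let emb : U.Ω × U.Ω → (U.Ω ⊕ H) × (U.Ω ⊕ H) := Prod.map Sum.inl Sum.inl
  let q₀ : (U.Ω ⊕ H) × (U.Ω ⊕ H) := (Sum.inl x, Sum.inr 1)
  let P' : Bool → Finset ((U.Ω ⊕ H) × (U.Ω ⊕ H)) :=
    Function.update (fun c => (U.P c).image emb) b (insert q₀ ((U.P b).image emb))
  have hP'b : P' b = insert q₀ ((U.P b).image emb) := Function.update_self _ _ _
  have hP'nb : P' (!b) = (U.P (!b)).image emb := Function.update_of_ne (by simp) _ _
  have hq₀ : smulGen H {q | ∃ c, q ∈ P' c} (Sum.inl x : U.Ω ⊕ H) (Sum.inr 1) :=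
    smulGen_of_mem (q := q₀) ⟨b, by rw [hP'b]; exact Finset.mem_insert_self _ _⟩
  have hsub : ∀ c, (U.P c).image emb ⊆ P' c := by
    intro c
    rcases Bool.eq_or_eq_not c b with rfl | rfl
    · rw [hP'b]
      exact Finset.subset_insert _ _
    · rw [hP'nb]
  have hemb : U.gen ≤ Setoid.comap Sum.inl (smulGen H {q | ∃ c, q ∈ P' c}) := by
    refine smulGen_le ((smulInvariant_smulGen _).comap fun _ _ => rfl) ?_
    rintro q ⟨c, hq⟩
    exact smulGen_of_mem (q := emb q) ⟨c, hsub c (Finset.mem_image_of_mem _ hq)⟩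
  have hcardP : (P' true).card + (P' false).card ≤
      (U.P true).card + (U.P false).card + 1 := by
    have h1 : (P' b).card ≤ (U.P b).card + 1 := by
      rw [hP'b]
      exact (Finset.card_insert_le _ _).trans (Nat.succ_le_succ Finset.card_image_le)
    have h2 : (P' (!b)).card ≤ (U.P (!b)).card := by
      rw [hP'nb]
      exact Finset.card_image_le
    cases b
    · simp only [Bool.not_false] at h2
      omega
    · simp only [Bool.not_true] at h2
      omega
  refine ⟨{ Ω := U.Ω ⊕ H
            p := Sum.elim U.p fun h => h • v'
            s := fun v => Sum.inl (U.s v)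
            p_smul := ?_
            s_smul := fun h v => congrArg Sum.inl (U.s_smul h v)
            p_s := U.p_s
            P := P'
            rel_P := ?_
            reach := ?_
            card_le := ?_ }, fun y z h => hemb h, Sum.inr 1, one_smul _ _,
              Setoid.trans' _ (hemb hx) hq₀⟩
  · rintro h (y | g)
    · exact U.p_smul h y
    · exact mul_smul h g v'
  · have himage : ∀ c, ∀ q ∈ (U.P c).image emb,
        α c (Sum.elim U.p (fun h : H => h • v') q.1) (Sum.elim U.p (fun h : H => h • v') q.2) := by
      intro c q hq
      obtain ⟨r, hr, rfl⟩ := Finset.mem_image.1 hq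
      exact U.rel_P c r hr
    intro c q hq
    rcases Bool.eq_or_eq_not c b with rfl | rfl
    · rw [hP'b] at hq
      rcases Finset.mem_insert.1 hq with rfl | hq
      · show α c (U.p x) ((1 : H) • v')
        rwa [one_smul]
      · exact himage _ q hq
    · rw [hP'nb] at hq
      exact himage _ q hq
  · rintro (y | h)
    · obtain ⟨v, hv⟩ := U.reach y
      exact ⟨v, hemb hv⟩
    · obtain ⟨v, hv⟩ := U.reach x
      refine ⟨h • v, ?_⟩
      have h1 := smulInvariant_smulGen (H := H) {q | ∃ c, q ∈ P' c} h _ _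
        (Setoid.trans' _ (hemb hv) hq₀)
      have h2 : h • (Sum.inr 1 : U.Ω ⊕ H) = Sum.inr h := congrArg Sum.inr (mul_one h)
      rw [h2] at h1
      rw [U.s_smul]
      exact h1
  · have := U.card_le
    omega

theorem exists_reaches (hα : α true ⊔ α false = ⊤) (U : Unfolding H V α k) (u v : V) :
    ∃ U' : Unfolding H V α k, U.rel ≤ U'.rel ∧ U'.Reaches u v := by
  let s : Set V := {v | ∃ U' : Unfolding H V α k, U.rel ≤ U'.rel ∧ U'.Reaches u v}
  have hstep : ∀ b v v', α b v v' → v ∈ s → v' ∈ s := by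
    rintro b v v' hv ⟨U₁, h₁, hr₁⟩
    obtain ⟨U₂, h₂, hr₂⟩ := U₁.exists_reaches_step hr₁ b hv
    exact ⟨U₂, h₁.trans h₂, hr₂⟩
  have hle : ∀ b, α b ≤ Setoid.ker (fun v => v ∈ s) := fun b v v' h =>
    propext ⟨hstep b v v' h, hstep b v' v ((α b).symm h)⟩
  have htop : Setoid.ker (fun v => v ∈ s) u v :=
    (sup_le (hle true) (hle false)) (by rw [hα]; trivial)
  have hu : u ∈ s := ⟨U, le_rfl, U.s u, U.p_s u, Setoid.refl' _ _⟩
  exact (Eq.mp htop hu : v ∈ s)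

theorem exists_rel_of_reaches (U : Unfolding H V α k) {u v : V} (hU : U.Reaches u v) :
    ∃ U' : Unfolding H V α (k + 1), U.rel ≤ U'.rel ∧ U'.rel u v := by
  classical
  obtain ⟨x, rfl, hx⟩ := hU
  let q₀ : U.Ω × U.Ω := (x, U.s (U.p x))
  let P' : Bool → Finset (U.Ω × U.Ω) := fun b => bif b then insert q₀ (U.P true) else U.P false
  have hle : U.gen ≤ smulGen H {q | ∃ c, q ∈ P' c} := by
    refine smulGen_mono ?_
    rintro q ⟨_ | _, hq⟩
    · exact ⟨false, hq⟩
    · exact ⟨true, Finset.mem_insert_of_mem hq⟩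
  have hrel : smulGen H {q | ∃ c, q ∈ P' c} (U.s u) (U.s (U.p x)) :=
    Setoid.trans' _ (hle hx) (smulGen_of_mem (q := q₀) ⟨true, Finset.mem_insert_self _ _⟩)
  refine ⟨{ Ω := U.Ω
            p := U.p
            s := U.s
            p_smul := U.p_smul
            s_smul := U.s_smul
            p_s := U.p_s
            P := P'
            rel_P := ?_
            reach := fun x => (U.reach x).imp fun _ h => hle h
            card_le := ?_ }, fun y z h => hle h, hrel⟩
  · rintro (_ | _) q hq
    · exact U.rel_P false q hq
    · rcases Finset.mem_insert.1 hq with rfl | hq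
      · show α true (U.p x) (U.p (U.s (U.p x)))
        rw [U.p_s]
      · exact U.rel_P true q hq
  · have h1 := Finset.card_insert_le q₀ (U.P true)
    have h2 := U.card_le
    show (insert q₀ (U.P true)).card + (U.P false).card + _ ≤ _
    omega

theorem exists_rel_of_finset [Finite (MulAction.orbitRel.Quotient H V)]
    (hα : α true ⊔ α false = ⊤) (D : Finset (V × V)) :
    ∃ U : Unfolding H V α D.card, ∀ q ∈ D, U.rel q.1 q.2 := by
  classical
  induction D using Finset.induction_on with
  | empty =>
    refine ⟨{ Ω := V
              p := id
              s := id
              p_smul := fun _ _ => rfl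
              s_smul := fun _ _ => rfl
              p_s := fun _ => rfl
              P := fun _ => ∅
              rel_P := by simp
              reach := fun x => ⟨x, Setoid.refl' _ _⟩
              card_le := by simp }, by simp⟩
  | insert q D hq ih =>
    obtain ⟨U, hU⟩ := ih
    obtain ⟨U₁, h₁, hr⟩ := U.exists_reaches hα q.1 q.2
    obtain ⟨U₂, h₂, hrel⟩ := U₁.exists_rel_of_reaches hr
    rw [Finset.card_insert_of_notMem hq]
    refine ⟨U₂, fun r hr => ?_⟩
    rcases Finset.mem_insert.1 hr with rfl | hr
    · exact hrel
    · exact h₂ (h₁ (hU r hr))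

theorem gen_eq_top (U : Unfolding H V α k) {D : Set (V × V)} (hD : smulGen H D = ⊤)
    (hU : ∀ q ∈ D, U.rel q.1 q.2) : U.gen = ⊤ := by
  have hrel : U.rel = ⊤ := by
    rw [eq_top_iff, ← hD]
    exact smulGen_le ((smulInvariant_smulGen _).comap U.s_smul) hU
  rw [eq_top_iff]
  intro x y _
  obtain ⟨u, hu⟩ := U.reach x
  obtain ⟨v, hv⟩ := U.reach y
  have huv : U.rel u v := by
    rw [hrel]
    trivial
  exact U.gen.trans (U.gen.symm hu) (U.gen.trans huv hv)

end Unfolding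

end Unfolding

section Cosets

variable {G : Type*} [Group G] {H K : Subgroup G} {Ω : Type*} [MulAction H Ω]

theorem natCard_quotient_orbitSup_ker [H.Normal] {p : Ω → G ⧸ K}
    (hp : ∀ (h : H) x, p (h • x) = h • p x) (hsurj : Function.Surjective p) :
    Nat.card (Quotient (orbitSup H (Setoid.ker p))) = (H ⊔ K).index := by
  let π : G ⧸ K → G ⧸ (H ⊔ K) := Subgroup.quotientMapOfLE le_sup_right
  have hπ : Function.Surjective (π ∘ p) := by
    refine Function.Surjective.comp ?_ hsurj
    rintro ⟨g⟩
    exact ⟨(g : G ⧸ K), rfl⟩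
  have hker : orbitSup H (Setoid.ker p) = Setoid.ker (π ∘ p) := by
    ext x y
    rw [orbitSup_rel (smulInvariant_ker hp), Setoid.ker_def]
    simp only [Setoid.ker_def, hp, Function.comp_apply]
    obtain ⟨a, ha⟩ := QuotientGroup.mk_surjective (p x)
    obtain ⟨b, hb⟩ := QuotientGroup.mk_surjective (p y)
    rw [← ha, ← hb]
    show (∃ h : H, (a : G ⧸ K) = ((h * b : G) : G ⧸ K)) ↔
      (a : G ⧸ (H ⊔ K)) = (b : G ⧸ (H ⊔ K))
    rw [QuotientGroup.eq, ← SetLike.mem_coe, Subgroup.normal_mul]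
    constructor
    · rintro ⟨h, hh⟩
      rw [QuotientGroup.eq] at hh
      refine ⟨a⁻¹ * (h : G)⁻¹ * a, ?_, a⁻¹ * (h * b), hh, by group⟩
      simpa using Subgroup.Normal.conj_mem ‹H.Normal› _ (inv_mem h.2) a⁻¹
    · rintro ⟨u, hu, k, hk, huk⟩
      simp only at huk
      refine ⟨⟨a * u⁻¹ * a⁻¹, Subgroup.Normal.conj_mem ‹H.Normal› _ (inv_mem hu) a⟩, ?_⟩
      rw [QuotientGroup.eq]
      have : a⁻¹ * (a * u⁻¹ * a⁻¹ * b) = k := by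
        rw [show a⁻¹ * (a * u⁻¹ * a⁻¹ * b) = u⁻¹ * (a⁻¹ * b) by group, ← huk]
        group
      rw [this]
      exact hk
  rw [hker, Subgroup.index]
  exact Nat.card_congr (Setoid.quotientKerEquivOfSurjective _ hπ)

/-- The stabilizer of a fibre of an equivariant map to `G ⧸ K` is conjugate to `K ⊓ H`. -/
theorem nonempty_classStabilizer_ker_equiv [H.Normal] {p : Ω → G ⧸ K}
    (hp : ∀ (h : H) x, p (h • x) = h • p x) (z : Ω) :
    Nonempty (classStabilizer H (smulInvariant_ker hp) z ≃* (K ⊓ H : Subgroup G)) := by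
  obtain ⟨a, ha⟩ := QuotientGroup.mk_surjective (p z)
  have hmap : (classStabilizer H (smulInvariant_ker hp) z).map H.subtype =
      (K ⊓ H).map (MulAut.conj a).toMonoidHom := by
    ext g
    have key : ∀ h : H, h ∈ classStabilizer H (smulInvariant_ker hp) z ↔ a⁻¹ * h * a ∈ K := by
      intro h
      show p z = p (h • z) ↔ _
      rw [hp, ← ha]
      show (a : G ⧸ K) = ((h * a : G) : G ⧸ K) ↔ _
      rw [QuotientGroup.eq, mul_assoc]
    simp only [Subgroup.mem_map, Subgroup.coe_subtype, MulEquiv.toMonoidHom_eq_coe,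
      MonoidHom.coe_coe, MulAut.conj_apply, Subgroup.mem_inf]
    constructor
    · rintro ⟨h, hh, rfl⟩
      refine ⟨a⁻¹ * h * a, ⟨(key h).1 hh, ?_⟩, by group⟩
      simpa using Subgroup.Normal.conj_mem ‹H.Normal› _ h.2 a⁻¹
    · rintro ⟨k, ⟨hk, hkH⟩, rfl⟩
      refine ⟨⟨a * k * a⁻¹, Subgroup.Normal.conj_mem ‹H.Normal› _ hkH a⟩, (key _).2 ?_, rfl⟩
      convert hk using 1
      group
  exact ⟨(Subgroup.equivMapOfInjective _ _ H.subtype_injective).trans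
    ((MulEquiv.subgroupCongr hmap).trans
      (Subgroup.equivMapOfInjective _ _ (MulAut.conj a).injective).symm)⟩

theorem card_orbits_add_index_mul_ngen_le [H.Normal] [Finite (MulAction.orbitRel.Quotient H Ω)]
    (hfree : ∀ (h : H) (x : Ω), h • x = x → h = 1) {p : Ω → G ⧸ K}
    (hp : ∀ (h : H) x, p (h • x) = h • p x) (hsurj : Function.Surjective p)
    (P : Finset (Ω × Ω)) (hP : smulGen H (P : Set (Ω × Ω)) = Setoid.ker p) :
    Nat.card (MulAction.orbitRel.Quotient H Ω) + (H ⊔ K).index * ngen (K ⊓ H : Subgroup G) ≤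
      P.card + (H ⊔ K).index := by
  rw [← natCard_quotient_orbitSup_ker hp hsurj]
  exact card_orbits_add_le_card hfree P (smulInvariant_ker hp) hP _ fun z =>
    (ngen_congr (nonempty_classStabilizer_ker_equiv hp z).some).ge

theorem exists_smulGen_eq_ker [H.Normal] [Finite (MulAction.orbitRel.Quotient H Ω)]
    [Group.FG (K ⊓ H : Subgroup G)] {p : Ω → G ⧸ K}
    (hp : ∀ (h : H) x, p (h • x) = h • p x) (hsurj : Function.Surjective p) :
    ∃ P : Finset (Ω × Ω), smulGen H (P : Set (Ω × Ω)) = Setoid.ker p ∧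
      P.card + (H ⊔ K).index ≤ Nat.card (MulAction.orbitRel.Quotient H Ω) +
        (H ⊔ K).index * ngen (K ⊓ H : Subgroup G) := by
  classical
  rw [← natCard_quotient_orbitSup_ker hp hsurj]
  refine exists_smulGen_eq (smulInvariant_ker hp) _ fun z => ?_
  have ψ := (nonempty_classStabilizer_ker_equiv hp z).some
  have : Group.FG (classStabilizer H (smulInvariant_ker hp) z) :=
    Group.fg_of_surjective (f := ψ.symm.toMonoidHom) ψ.symm.surjective
  obtain ⟨S, hcard, hS⟩ := exists_card_eq_ngen (classStabilizer H (smulInvariant_ker hp) z)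
  refine ⟨S.image Subtype.val, ?_, ?_⟩
  · exact Finset.card_image_le.trans (hcard.trans (ngen_congr ψ)).le
  · have := MonoidHom.map_closure (classStabilizer H (smulInvariant_ker hp) z).subtype (S : Set _)
    rw [hS, ← MonoidHom.range_eq_map, Subgroup.range_subtype] at this
    rw [Finset.coe_image]
    exact this.symm

theorem eq_one_of_smul_quotient_eq [H.Normal] (hHK : H ⊓ K = ⊥) (h : H) (v : G ⧸ K)
    (hv : h • v = v) : h = 1 := by
  obtain ⟨a, rfl⟩ := QuotientGroup.mk_surjective v
  have h1 : (a : G ⧸ K) = ((h * a : G) : G ⧸ K) := hv.symm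
  rw [QuotientGroup.eq] at h1
  have h2 : a⁻¹ * (h * a) ∈ H ⊓ K := by
    refine ⟨?_, h1⟩
    simpa [mul_assoc] using Subgroup.Normal.conj_mem ‹H.Normal› _ h.2 a⁻¹
  rw [hHK, Subgroup.mem_bot] at h2
  ext
  have : (h : G) = a * (a⁻¹ * (h * a)) * a⁻¹ := by group
  rw [this, h2]
  simp

theorem natCard_orbits_quotient [H.Normal] :
    Nat.card (MulAction.orbitRel.Quotient H (G ⧸ K)) = (H ⊔ K).index := by
  rw [← natCard_quotient_orbitSup_ker (H := H) (p := (id : G ⧸ K → G ⧸ K)) (fun _ _ => rfl)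
    Function.surjective_id, Setoid.ker_eq_bot_iff.2 Function.injective_id, orbitSup_bot]

theorem finite_orbits_quotient [H.Normal] (hfin : H.index ≠ 0) :
    Finite (MulAction.orbitRel.Quotient H (G ⧸ K)) := by
  refine Nat.finite_of_card_ne_zero ?_
  rw [natCard_orbits_quotient]
  exact fun h => hfin (Nat.eq_zero_of_zero_dvd (h ▸ Subgroup.index_dvd_of_le le_sup_left))

theorem index_eq_index_sup_mul_card [H.Normal] (hHK : H ⊓ K = ⊥) :
    H.index = (H ⊔ K).index * Nat.card K := by
  rw [← Subgroup.relIndex_mul_index (le_sup_left : H ≤ H ⊔ K), mul_comm, sup_comm,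
    Subgroup.relIndex_sup_right, ← Subgroup.inf_relIndex_right, hHK, Subgroup.relIndex_bot_left]

end Cosets

section CosetTree

universe w

variable {G : Type w} [Group G] {H C : Subgroup G} {F : Bool → Subgroup G}

/-- Two cosets of `C` are related when they lie in the same coset of the larger subgroup `K`. -/
def cosetSetoid {C K : Subgroup G} (h : C ≤ K) : Setoid (G ⧸ C) :=
  Setoid.ker (Subgroup.quotientMapOfLE h)

theorem cosetSetoid_mk {C K : Subgroup G} (h : C ≤ K) (a b : G) :
    cosetSetoid h (a : G ⧸ C) (b : G ⧸ C) ↔ a⁻¹ * b ∈ K := by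
  rw [← QuotientGroup.eq]
  rfl

theorem quotientMapOfLE_smul {C K : Subgroup G} (h : C ≤ K) (x : H) (v : G ⧸ C) :
    Subgroup.quotientMapOfLE h (x • v) = x • Subgroup.quotientMapOfLE h v := by
  obtain ⟨a, rfl⟩ := QuotientGroup.mk_surjective v
  rfl

theorem quotientMapOfLE_surjective {C K : Subgroup G} (h : C ≤ K) :
    Function.Surjective (Subgroup.quotientMapOfLE h) := by
  rintro ⟨g⟩
  exact ⟨(g : G ⧸ C), rfl⟩

theorem cosetSetoid_sup_eq_top (hCF : ∀ b, C ≤ F b) (hF : F true ⊔ F false = ⊤) :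
    cosetSetoid (hCF true) ⊔ cosetSetoid (hCF false) = ⊤ := by
  set T := cosetSetoid (hCF true) ⊔ cosetSetoid (hCF false) with hT
  have hstep : ∀ b, ∀ k ∈ F b, ∀ a : G, T (a : G ⧸ C) ((a * k : G) : G ⧸ C) := by
    intro b k hk a
    have h1 : cosetSetoid (hCF b) (a : G ⧸ C) ((a * k : G) : G ⧸ C) := by
      rw [cosetSetoid_mk]
      simpa using hk
    cases b
    · exact (le_sup_right : _ ≤ T) h1
    · exact (le_sup_left : _ ≤ T) h1
  have key : ∀ k ∈ F true ⊔ F false, ∀ a : G, T (a : G ⧸ C) ((a * k : G) : G ⧸ C) := by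
    intro k hk
    rw [← Subgroup.closure_eq (F true), ← Subgroup.closure_eq (F false),
      ← Subgroup.closure_union] at hk
    induction hk using Subgroup.closure_induction with
    | mem k hk =>
      rcases hk with hk | hk
      · exact hstep true k hk
      · exact hstep false k hk
    | one =>
      intro a
      rw [mul_one]
    | mul k l _ _ hk hl =>
      intro a
      have := T.trans (hk a) (hl (a * k))
      rwa [mul_assoc] at this
    | inv k _ hk =>
      intro a
      have := T.symm (hk (a * k⁻¹))
      rwa [inv_mul_cancel_right] at this
  rw [eq_top_iff]
  intro u v _
  obtain ⟨a, rfl⟩ := QuotientGroup.mk_surjective u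
  obtain ⟨b, rfl⟩ := QuotientGroup.mk_surjective v
  have := key (a⁻¹ * b) (hF ▸ Subgroup.mem_top _) a
  rwa [mul_inv_cancel_left] at this

theorem ngen_top_inf : ngen (⊤ ⊓ H : Subgroup G) = ngen H :=
  ngen_congr (MulEquiv.subgroupCongr (top_inf_eq H))

theorem ker_quotient_top {Ω : Type*} (p : Ω → G ⧸ (⊤ : Subgroup G)) : Setoid.ker p = ⊤ := by
  rw [eq_top_iff]
  intro x y _
  have := QuotientGroup.subsingleton_quotient_top (G := G)
  exact Subsingleton.elim _ _

theorem index_sup_top : (H ⊔ ⊤ : Subgroup G).index = 1 := by simp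

variable [H.Normal]

/-- The upper bound for the number of generators of `H`. -/
theorem ngen_add_le (hfin : H.index ≠ 0) (hHC : H ⊓ C = ⊥) (hCF : ∀ b, C ≤ F b)
    (hF : F true ⊔ F false = ⊤) (hfg : ∀ b, Group.FG (F b ⊓ H : Subgroup G)) :
    ngen H + (H ⊔ F true).index + (H ⊔ F false).index ≤
      (H ⊔ C).index + (H ⊔ F true).index * ngen (F true ⊓ H : Subgroup G) +
        (H ⊔ F false).index * ngen (F false ⊓ H : Subgroup G) + 1 := by
  classical
  have := finite_orbits_quotient (K := C) hfin
  have hex := fun b => exists_smulGen_eq_ker (H := H) (quotientMapOfLE_smul (hCF b))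
    (quotientMapOfLE_surjective (hCF b))
  choose P hP hcard using hex
  have hsub : ∀ b, (P b : Set ((G ⧸ C) × (G ⧸ C))) ⊆ (P true ∪ P false : Finset _) := by
    rintro (_ | _)
    · exact Finset.coe_subset.2 Finset.subset_union_right
    · exact Finset.coe_subset.2 Finset.subset_union_left
  have hgen : smulGen H ((P true ∪ P false : Finset _) : Set _) =
      Setoid.ker (Subgroup.quotientMapOfLE (le_top : C ≤ ⊤)) := by
    rw [ker_quotient_top, eq_top_iff, ← cosetSetoid_sup_eq_top hCF hF]
    have hle : ∀ b, cosetSetoid (hCF b) ≤ smulGen H ((P true ∪ P false : Finset _) : Set _) :=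
      fun b => (hP b).ge.trans (smulGen_mono (hsub b))
    exact sup_le (hle true) (hle false)
  have hlow := card_orbits_add_index_mul_ngen_le (eq_one_of_smul_quotient_eq hHC)
    (quotientMapOfLE_smul _) (quotientMapOfLE_surjective _) _ hgen
  rw [index_sup_top, ngen_top_inf, natCard_orbits_quotient] at hlow
  have h1 := hcard true
  have h2 := hcard false
  have h3 := Finset.card_union_le (P true) (P false)
  rw [natCard_orbits_quotient] at h1 h2
  omega

/-- The lower bound for the number of generators of `H`, when the incidence graph of the cosets of
`F true` and `F false` is a forest. -/
theorem add_le_ngen (hfin : H.index ≠ 0) (hHC : H ⊓ C = ⊥) (hCF : ∀ b, C ≤ F b)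
    (hF : F true ⊔ F false = ⊤) [hfg : Group.FG H]
    (htree : ∀ b u, ¬ ReducedPath id (fun b => cosetSetoid (hCF b)) b u u) :
    (H ⊔ C).index + (H ⊔ F true).index * ngen (F true ⊓ H : Subgroup G) +
        (H ⊔ F false).index * ngen (F false ⊓ H : Subgroup G) + 1 ≤
      ngen H + (H ⊔ F true).index + (H ⊔ F false).index := by
  have := finite_orbits_quotient (K := C) hfin
  have hfg' : Group.FG (⊤ ⊓ H : Subgroup G) := by rwa [top_inf_eq]
  have hfree := eq_one_of_smul_quotient_eq hHC
  obtain ⟨D, hD, hDcard⟩ := exists_smulGen_eq_ker (H := H)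
    (quotientMapOfLE_smul (le_top : C ≤ ⊤)) (quotientMapOfLE_surjective (le_top : C ≤ ⊤))
  rw [ker_quotient_top] at hD
  rw [index_sup_top, ngen_top_inf, natCard_orbits_quotient] at hDcard
  obtain ⟨U, hU⟩ := Unfolding.exists_rel_of_finset (H := H)
    (α := fun b => cosetSetoid (hCF b)) (cosetSetoid_sup_eq_top hCF hF) D
  have htop := U.gen_eq_top hD hU
  have hUcard := U.card_le
  rw [natCard_orbits_quotient] at hUcard
  obtain ⟨P, R, hP, hR, hRp, hRP, hsub, hPR, hcard⟩ := exists_folded U.p_smul hfree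
    (Nat.card (Quotient (orbitSup H (⊥ : Setoid U.Ω)))) U.P ⊥ U.rel_P smulInvariant_bot bot_le
    (fun _ => bot_le) rfl
  rw [orbitSup_bot] at hcard
  have hinv : ∀ b, SMulInvariant H (Setoid.comap U.p (cosetSetoid (hCF b))) := fun b =>
    (smulInvariant_ker (quotientMapOfLE_smul (hCF b))).comap U.p_smul
  have hX : ∀ b, smulGen H (P b : Set (U.Ω × U.Ω)) ≤ Setoid.comap U.p (cosetSetoid (hCF b)) :=
    fun b => smulGen_le (hinv b) (hP b)
  have hconn : smulGen H (P true : Set (U.Ω × U.Ω)) ⊔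
      smulGen H (P false : Set (U.Ω × U.Ω)) = ⊤ := by
    rw [eq_top_iff, ← htop]
    refine smulGen_le ((smulInvariant_smulGen _).sup (smulInvariant_smulGen _)) ?_
    rintro q ⟨_ | _, hq⟩
    · exact (le_sup_right : smulGen H (P false : Set (U.Ω × U.Ω)) ≤ _)
        (smulGen_of_mem (hsub false hq))
    · exact (le_sup_left : smulGen H (P true : Set (U.Ω × U.Ω)) ≤ _)
        (smulGen_of_mem (hsub true hq))
  have hsurj : Function.Surjective U.p := fun v => ⟨_, U.p_s v⟩
  have hRker : R = Setoid.ker U.p :=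
    le_antisymm hRp (ker_le_of_no_reduced_loop htree hX hRp hRP hPR hconn)
  rw [hRker, natCard_quotient_orbitSup_ker U.p_smul hsurj] at hcard
  have hfree' : ∀ (h : H) (x : U.Ω), h • x = x → h = 1 := fun h x hx =>
    hfree h (U.p x) (by rw [← U.p_smul, hx])
  have hlow := fun b => card_orbits_add_index_mul_ngen_le hfree'
    (p := Subgroup.quotientMapOfLE (hCF b) ∘ U.p)
    (fun h x => by
      rw [Function.comp_apply, U.p_smul, quotientMapOfLE_smul]
      rfl)
    ((quotientMapOfLE_surjective (hCF b)).comp hsurj) (P b)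
    (le_antisymm (hX b) (comap_le_of_no_reduced_loop htree hX hRp hRP hPR hconn b))
  have h1 := hlow true
  have h2 := hlow false
  change _ ≤ _ + Nat.card (MulAction.orbitRel.Quotient H U.Ω) at hcard
  omega

end CosetTree

section NormalForm

variable {A B : Type u} {C : Type v} [Group A] [Group B] [Group C] {f : C →* A} {g : C →* B}

theorem range_base_le_range_of (b : Bool) :
    (PushoutI.base (fam2 f g)).range ≤ (PushoutI.of (φ := fam2 f g) b).range := by
  rintro _ ⟨c, rfl⟩
  exact ⟨fam2 f g b c, PushoutI.of_apply_eq_base (fam2 f g) b c⟩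

theorem range_of_sup_range_of :
    (PushoutI.of (φ := fam2 f g) true).range ⊔ (PushoutI.of (φ := fam2 f g) false).range = ⊤ := by
  rw [eq_top_iff]
  rintro x -
  induction x using PushoutI.induction_on with
  | of b a =>
    cases b
    · exact Subgroup.mem_sup_right ⟨a, rfl⟩
    · exact Subgroup.mem_sup_left ⟨a, rfl⟩
  | base c => exact Subgroup.mem_sup_left (range_base_le_range_of true ⟨c, rfl⟩)
  | mul x y hx hy => exact mul_mem hx hy

theorem exists_neWord_of_reducedPath {b : Bool}
    {u v : PushoutI (fam2 f g) ⧸ (PushoutI.base (fam2 f g)).range}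
    (h : ReducedPath id (fun b => cosetSetoid (range_base_le_range_of (f := f) (g := g) b)) b u v)
    (x : PushoutI (fam2 f g)) (hx : (x : _ ⧸ (PushoutI.base (fam2 f g)).range) = u) :
    ∃ (i : Bool) (w : CoprodI.NeWord (Fam A B) i b), PushoutI.Reduced (fam2 f g) w.toWord ∧
      ((x * PushoutI.ofCoprodI w.prod : PushoutI (fam2 f g)) :
        _ ⧸ (PushoutI.base (fam2 f g)).range) = v := by
  have hstep : ∀ (b : Bool) (y : PushoutI (fam2 f g))
      (v : PushoutI (fam2 f g) ⧸ (PushoutI.base (fam2 f g)).range),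
      cosetSetoid (range_base_le_range_of (f := f) (g := g) b) y v →
      (y : _ ⧸ (PushoutI.base (fam2 f g)).range) ≠ v →
      ∃ a : Fam A B b, a ∉ (fam2 f g b).range ∧
        ((y * PushoutI.of b a : PushoutI (fam2 f g)) : _ ⧸ (PushoutI.base (fam2 f g)).range) = v := by
    intro b y v hyv hne
    obtain ⟨z, rfl⟩ := QuotientGroup.mk_surjective v
    obtain ⟨a, ha⟩ := (cosetSetoid_mk _ _ _).1 hyv
    refine ⟨a, ?_, by rw [ha, mul_inv_cancel_left]⟩
    rintro ⟨c, rfl⟩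
    refine hne (QuotientGroup.eq.2 ⟨c, ?_⟩)
    rw [← ha, ← PushoutI.of_apply_eq_base (fam2 f g) b c]
  have hone : ∀ {b : Bool} {a : Fam A B b}, a ∉ (fam2 f g b).range → a ≠ 1 := by
    rintro b a ha rfl
    exact ha (one_mem _)
  induction h with
  | single hxy hne =>
    subst hx
    obtain ⟨a, ha, hv⟩ := hstep _ _ _ hxy hne
    refine ⟨_, .singleton a (hone ha), ?_, ?_⟩
    · rintro l hl
      simp only [CoprodI.NeWord.toWord, CoprodI.NeWord.toList, List.mem_singleton] at hl
      subst hl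
      exact ha
    · simpa using hv
  | @snoc b u y z _ hyz hne ih =>
    obtain ⟨i, w, hw, hy⟩ := ih hx
    subst hy
    obtain ⟨a, ha, hv⟩ := hstep _ _ _ hyz hne
    refine ⟨i, .append w (by simp) (.singleton a (hone ha)), ?_, ?_⟩
    · rintro l hl
      simp only [CoprodI.NeWord.toWord, CoprodI.NeWord.toList, List.mem_append,
        List.mem_singleton] at hl
      rcases hl with hl | rfl
      · exact hw l hl
      · exact ha
    · simpa [mul_assoc] using hv

theorem fam2_injective (hf : Function.Injective f) (hg : Function.Injective g) (b : Bool) :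
    Function.Injective (fam2 f g b) := by
  cases b
  · exact hg
  · exact hf

theorem not_reducedPath_self (hf : Function.Injective f) (hg : Function.Injective g) (b : Bool)
    (u : PushoutI (fam2 f g) ⧸ (PushoutI.base (fam2 f g)).range) :
    ¬ ReducedPath id (fun b => cosetSetoid (range_base_le_range_of (f := f) (g := g) b)) b u u := by
  intro h
  obtain ⟨x, rfl⟩ := QuotientGroup.mk_surjective u
  obtain ⟨i, w, hw, hx⟩ := exists_neWord_of_reducedPath h x rfl
  have hmem : PushoutI.ofCoprodI w.toWord.prod ∈ (PushoutI.base (fam2 f g)).range := by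
    show PushoutI.ofCoprodI w.prod ∈ _
    simpa using QuotientGroup.eq.1 hx.symm
  have := hw.eq_empty_of_mem_range (fam2_injective hf hg) hmem
  exact w.toList_ne_nil (congrArg CoprodI.Word.toList this)

end NormalForm

theorem fg_inf_of_index_ne_zero {G : Type*} [Group G] {H K : Subgroup G} [Group.FG K]
    (hfin : H.index ≠ 0) : Group.FG (K ⊓ H : Subgroup G) := by
  have : H.FiniteIndex := ⟨hfin⟩
  have e : H.subgroupOf K ≃* (K ⊓ H : Subgroup G) :=
    (Subgroup.equivMapOfInjective _ _ K.subtype_injective).trans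
      (MulEquiv.subgroupCongr (by rw [Subgroup.subgroupOf_map_subtype, inf_comm]))
  exact Group.fg_of_surjective (f := e.toMonoidHom) e.surjective

/-- Grushko–Neumann count for a finite-index normal subgroup `H` of an amalgam
`G = A *_C B` of finitely generated groups over a finite subgroup `C` with `H ∩ C = 1`:
`d(H) - 1 = [G : HA](d(A ∩ H) - 1) + [G : HB](d(B ∩ H) - 1) + [G : H]/|C|`. -/
theorem ngen_amalgam_formula {A B : Type u} {C : Type v} [Group A] [Group B] [Group C]
    [Group.FG A] [Group.FG B] [Finite C]
    (f : C →* A) (g : C →* B) (hf : Function.Injective f) (hg : Function.Injective g)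
    (H : Subgroup (PushoutI (fam2 f g))) [H.Normal] (hfin : H.index ≠ 0)
    (hHC : H ⊓ (PushoutI.base (fam2 f g)).range = ⊥) :
    (ngen ↥H : ℝ) - 1 =
      ((H ⊔ (PushoutI.of (φ := fam2 f g) true).range).index : ℝ) *
          ((ngen ↥((PushoutI.of (φ := fam2 f g) true).range ⊓ H) : ℝ) - 1) +
        ((H ⊔ (PushoutI.of (φ := fam2 f g) false).range).index : ℝ) *
          ((ngen ↥((PushoutI.of (φ := fam2 f g) false).range ⊓ H) : ℝ) - 1) +
        (H.index : ℝ) / (Nat.card C : ℝ) := by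
  have hfgF : ∀ b, Group.FG (PushoutI.of (φ := fam2 f g) b).range := by
    intro b
    have : Group.FG (Fam A B b) := by
      cases b
      · exact ‹Group.FG B›
      · exact ‹Group.FG A›
    exact Group.fg_range _
  have hfgG : Group.FG (PushoutI (fam2 f g)) := by
    rw [Group.fg_def, ← range_of_sup_range_of]
    exact ((Group.fg_iff_subgroup_fg _).1 (hfgF true)).sup
      ((Group.fg_iff_subgroup_fg _).1 (hfgF false))
  have : H.FiniteIndex := ⟨hfin⟩
  have hupper := ngen_add_le hfin hHC range_base_le_range_of range_of_sup_range_of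
    fun b => fg_inf_of_index_ne_zero hfin
  have hlower := add_le_ngen hfin hHC range_base_le_range_of range_of_sup_range_of
    (not_reducedPath_self hf hg)
  have hcardC : Nat.card (PushoutI.base (fam2 f g)).range = Nat.card C :=
    Nat.card_congr (MonoidHom.ofInjective (PushoutI.base_injective (fam2_injective hf hg))).symm
  have hC : (Nat.card C : ℝ) ≠ 0 := Nat.cast_ne_zero.2 Nat.card_pos.ne'
  have heq := le_antisymm hupper hlower
  have hcast := congrArg (Nat.cast : ℕ → ℝ) heq
  push_cast at hcast
  rw [index_eq_index_sup_mul_card hHC, hcardC, Nat.cast_mul, mul_div_cancel_right₀ _ hC]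
  linarith
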